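/- arXiv:2012.01628 — 3 statements merged into one kernel-verified Lean document; each statement's English description precedes it below -/
import Mathlib

section
/- (Perturbation formula) Let m, n be positive integers with m < n, let a_0, …, a_{n−1} ∈ F be nodes, and let δ_m ∈ F. Then g̃_n(x; a_0, …, a_{m−1}, a_m + δ_m, a_{m+1}, …, a_{n−1}) = g̃_n(x; a_0, …, a_{n−1}) − C(n,m) · g̃_{n−m}(a_m + δ_m; a_m, a_{m+1}, …, a_{n−1}) · g̃_m(x; a_0, a_1, …, a_{m−1}), where C(n,m) is the binomial coefficient and g̃_{n−m}(a_m + δ_m; a_m, …, a_{n−1}) is the evaluation of g̃_{n−m}(x; a_m, …, a_{n−1}) at x = a_m + δ_m. -/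
open Polynomial Finset

/-- The backward difference operator `(Δ p)(x) = p(x) - p(x-1)` on `F[x]`. -/
noncomputable def bdiff {F : Type*} [Field F] (p : F[X]) : F[X] :=
  p - p.comp (X - C 1)

/-- The upper (rising) factorial `t^{(0)} = 1`, `t^{(k)} = t(t+1)⋯(t+k-1)`,
in a commutative ring. -/
def upf {R : Type*} [CommRing R] (t : R) : ℕ → R
  | 0 => 1
  | k + 1 => upf t k * (t + (k : R))

/-- `g` is the `n`-th univariate difference Gončarov polynomial
`g̃_n(x; a_0, …, a_{n-1})` for the nodes `a`: it is the unique polynomial of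
degree `n` satisfying the biorthogonality conditions `(Δ^s g)(a_s) = n!·δ_{s,n}`
for `0 ≤ s ≤ n`.  (For `s = n` the condition says that the constant polynomial
`Δ^n g` equals `n!`; together with `natDegree g ≤ n` this forces the degree to
be exactly `n`.)  Only the nodes `a_0, …, a_{n-1}` are used. -/
def IsDiffGoncarov {F : Type*} [Field F] (n : ℕ) (a : ℕ → F) (g : F[X]) : Prop :=
  g.natDegree ≤ n ∧ (∀ s < n, (bdiff^[s] g).eval (a s) = 0) ∧
    bdiff^[n] g = C (n.factorial : F)

theorem bdiff_iter_sub {F : Type*} [Field F] (s : ℕ) (p q : F[X]) :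
    bdiff^[s] (p - q) = bdiff^[s] p - bdiff^[s] q := by
  induction s generalizing p q with
  | zero => rfl
  | succ k ih =>
    have : bdiff (p - q) = bdiff p - bdiff q := by
      simp only [bdiff, sub_comp]; ring
    simp only [Function.iterate_succ_apply, this, ih]

theorem bdiff_iter_C_mul {F : Type*} [Field F] (s : ℕ) (c : F) (p : F[X]) :
    bdiff^[s] (C c * p) = C c * bdiff^[s] p := by
  induction s generalizing p with
  | zero => rfl
  | succ k ih =>
    have : bdiff (C c * p) = C c * bdiff p := by
      simp only [bdiff, mul_comp, C_comp]; ring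
    simp only [Function.iterate_succ_apply, this, ih]

theorem bdiff_iter_C {F : Type*} [Field F] (s : ℕ) (c : F) :
    bdiff^[s + 1] (C c) = 0 := by
  induction s with
  | zero => simp [bdiff]
  | succ k ih =>
    rw [Function.iterate_succ_apply', ih]; simp [bdiff]

theorem eq_C_of_bdiff {F : Type*} [Field F] [CharZero F] (p : F[X]) (h : bdiff p = 0) :
    p = C (p.eval 0) := by
  have hstep : ∀ x : F, p.eval x = p.eval (x - 1) := by
    intro x
    have := congrArg (eval x) h
    simp only [bdiff, eval_sub, eval_comp, eval_X, eval_C, eval_zero] at this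
    exact sub_eq_zero.mp this
  have hn : ∀ k : ℕ, p.eval (k : F) = p.eval 0 := by
    intro k
    induction k with
    | zero => simp
    | succ k ih => rw [hstep]; simpa using ih
  apply Polynomial.eq_of_infinite_eval_eq
  refine (Set.infinite_range_of_injective (Nat.cast_injective (R := F))).mono ?_
  rintro _ ⟨k, rfl⟩
  simp [hn k]

theorem bdiff_unique {F : Type*} [Field F] [CharZero F] (n : ℕ) (b : ℕ → F) (p : F[X])
    (h0 : ∀ s < n, (bdiff^[s] p).eval (b s) = 0) (hn : bdiff^[n] p = 0) : p = 0 := by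
  induction n generalizing b p with
  | zero => simpa using hn
  | succ k ih =>
    have h1 : bdiff p = 0 := by
      apply ih (fun i => b (i + 1)) (bdiff p)
      · intro s hs
        have := h0 (s + 1) (by omega)
        rwa [Function.iterate_succ_apply] at this
      · rwa [Function.iterate_succ_apply] at hn
    have h2 := eq_C_of_bdiff p h1
    have h3 := h0 0 (by omega)
    rw [Function.iterate_zero_apply, h2, eval_C] at h3
    rw [h2, h3, C_0]

/-- **Perturbation formula.** For `0 < m < n`, perturbing the node `a_m` to `a_m + δ`
changes the difference Gončarov polynomial by
`g̃_n(x; …, a_m + δ, …) = g̃_n(x; a_0, …, a_{n-1})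
  - C(n,m) · g̃_{n-m}(a_m + δ; a_m, …, a_{n-1}) · g̃_m(x; a_0, …, a_{m-1})`. -/
theorem perturbation_formula (F : Type*) [Field F] [CharZero F] (m n : ℕ)
    (hm : 0 < m) (hmn : m < n) (a : ℕ → F) (δ : F) (g g' h gm : F[X])
    (hg : IsDiffGoncarov n a g)
    (hg' : IsDiffGoncarov n (Function.update a m (a m + δ)) g')
    (hh : IsDiffGoncarov (n - m) (fun i => a (m + i)) h)
    (hgm : IsDiffGoncarov m a gm) :
    g' = g - C ((n.choose m : F) * h.eval (a m + δ)) * gm := by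
  obtain ⟨k, rfl⟩ : ∃ k, n = m + k := ⟨n - m, by omega⟩
  obtain ⟨-, hg1, hg2⟩ := hg
  obtain ⟨-, hg1', hg2'⟩ := hg'
  obtain ⟨-, hh1, hh2⟩ := hh
  obtain ⟨-, hm1, hm2⟩ := hgm
  rw [Nat.add_sub_cancel_left] at hh1 hh2
  have key : C (k.factorial : F) * bdiff^[m] g - C ((m + k).factorial : F) * h = 0 := by
    apply bdiff_unique k (fun i => a (m + i))
    · intro s hs
      rw [bdiff_iter_sub, bdiff_iter_C_mul, bdiff_iter_C_mul, ← Function.iterate_add_apply,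
        eval_sub, eval_mul, eval_mul, hh1 s hs, add_comm s m, hg1 (m + s) (by omega)]
      simp
    · rw [bdiff_iter_sub, bdiff_iter_C_mul, bdiff_iter_C_mul, ← Function.iterate_add_apply,
        hh2, add_comm k m, hg2]
      ring
  have hgm0 : ∀ s, m < s → bdiff^[s] gm = 0 := by
    intro s hs
    obtain ⟨j, rfl⟩ : ∃ j, s = (j + 1) + m := ⟨s - m - 1, by omega⟩
    rw [Function.iterate_add_apply, hm2, bdiff_iter_C]
  symm
  rw [← sub_eq_zero]
  apply bdiff_unique (m + k) (Function.update a m (a m + δ))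
  · intro s hs
    rw [bdiff_iter_sub, eval_sub, hg1' s hs, bdiff_iter_sub, bdiff_iter_C_mul, sub_zero]
    rcases lt_trichotomy s m with h1 | h1 | h1
    · rw [Function.update_of_ne h1.ne, eval_sub, eval_mul, hg1 s hs, hm1 s h1]
      simp
    · subst h1
      rw [Function.update_self, hm2]
      have e := congrArg (eval (a s + δ)) key
      simp only [eval_sub, eval_mul, eval_C, eval_zero] at e ⊢
      have hk : (k.factorial : F) ≠ 0 := Nat.cast_ne_zero.mpr k.factorial_ne_zero
      have hc : ((s + k).choose s : F) * s.factorial * k.factorial = (s + k).factorial := by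
        have := Nat.choose_mul_factorial_mul_factorial (Nat.le_add_right s k)
        rw [Nat.add_sub_cancel_left] at this
        exact_mod_cast this
      apply mul_left_cancel₀ hk
      rw [← hc] at e
      linear_combination e
    · rw [Function.update_of_ne h1.ne', hgm0 s h1, mul_zero, sub_zero, hg1 s hs]
  · rw [bdiff_iter_sub, bdiff_iter_sub, bdiff_iter_C_mul, hgm0 _ hmn, hg2, hg2']
    simp
end

section
/- (Bivariate perturbation formula) Let Z be a node set, m, n ∈ ℕ, and let (i₀,j₀) ≼ (m,n) with (i₀,j₀) ≠ (m,n). Let Z* be the node set obtained from Z by replacing the node z_{i₀,j₀} with a point z*_{i₀,j₀} ∈ F², all other nodes unchanged. Then g̃_{m,n}((x,y); Z*) = g̃_{m,n}((x,y); Z) − C(m,i₀)·C(n,j₀)·g̃_{m−i₀, n−j₀}(z*_{i₀,j₀}; L^{i₀} D^{j₀} Z)·g̃_{i₀,j₀}((x,y); Z), where g̃_{m−i₀,n−j₀}(z*_{i₀,j₀}; L^{i₀}D^{j₀}Z) denotes evaluation at the point z*_{i₀,j₀}, C denotes binomial coefficients, and L^{i₀}D^{j₀}Z is the node set whose (k,l)-node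 is z_{k+i₀, l+j₀}. -/
open Finset

/-- The partial backward difference operator in the first variable:
`(Δ_x p)(x,y) = p(x,y) - p(x-1,y)`. -/
noncomputable def bdiffx {F : Type*} [Field F] (p : MvPolynomial (Fin 2) F) :
    MvPolynomial (Fin 2) F :=
  p - MvPolynomial.aeval ![MvPolynomial.X 0 - 1, MvPolynomial.X 1] p

/-- The partial backward difference operator in the second variable:
`(Δ_y p)(x,y) = p(x,y) - p(x,y-1)`. -/
noncomputable def bdiffy {F : Type*} [Field F] (p : MvPolynomial (Fin 2) F) :
    MvPolynomial (Fin 2) F :=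
  p - MvPolynomial.aeval ![MvPolynomial.X 0, MvPolynomial.X 1 - 1] p

/-- `g` is the bivariate difference Gončarov polynomial `g̃_{m,n}((x,y); Z)` for
the node set `Z = {z_{i,j}}`: it is the unique polynomial of degree at most `m`
in `x` and at most `n` in `y` satisfying
`(Δ_x^i Δ_y^j g)(z_{i,j}) = m!·n!·δ_{i,m}·δ_{j,n}` for all `(i,j) ≼ (m,n)`. -/
def IsDiffGoncarov2 {F : Type*} [Field F] (m n : ℕ) (Z : ℕ → ℕ → F × F)
    (g : MvPolynomial (Fin 2) F) : Prop :=
  g.degreeOf 0 ≤ m ∧ g.degreeOf 1 ≤ n ∧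
    ∀ i ≤ m, ∀ j ≤ n,
      MvPolynomial.eval ![(Z i j).1, (Z i j).2] (bdiffx^[i] (bdiffy^[j] g)) =
        if i = m ∧ j = n then ((m.factorial : F) * (n.factorial : F)) else 0

open MvPolynomial in
/-- The backward difference operator in the variable `i`, as a linear map. -/
noncomputable def Dl (F : Type*) [Field F] (i : Fin 2) : Module.End F (MvPolynomial (Fin 2) F) :=
  LinearMap.id - (aeval (Function.update (X : Fin 2 → MvPolynomial (Fin 2) F) i (X i - 1))).toLinearMap

/-- Mixed iterated differences. -/
noncomputable def Tl (F : Type*) [Field F] (i j : ℕ) : Module.End F (MvPolynomial (Fin 2) F) :=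
  Dl F 0 ^ i * Dl F 1 ^ j

section
open MvPolynomial
variable {F : Type*} [Field F]

theorem Dl_apply (i : Fin 2) (p : MvPolynomial (Fin 2) F) :
    Dl F i p = p - aeval (Function.update (X : Fin 2 → MvPolynomial (Fin 2) F) i (X i - 1)) p := rfl

theorem bdiffx_eq : (bdiffx : MvPolynomial (Fin 2) F → _) = ⇑(Dl F 0) := by
  funext p
  rw [Dl_apply, bdiffx]
  congr 3
  funext k
  fin_cases k <;> simp

theorem bdiffy_eq : (bdiffy : MvPolynomial (Fin 2) F → _) = ⇑(Dl F 1) := by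
  funext p
  rw [Dl_apply, bdiffy]
  congr 3
  funext k
  fin_cases k <;> simp

theorem iter_eq (i j : ℕ) (p : MvPolynomial (Fin 2) F) :
    bdiffx^[i] (bdiffy^[j] p) = Tl F i j p := by
  rw [bdiffx_eq, bdiffy_eq, Tl, Module.End.mul_apply, Module.End.pow_apply, Module.End.pow_apply]

theorem Dl_comm : Commute (Dl F 0) (Dl F 1) := by
  have key : Commute
      (aeval (R := F) (Function.update (X : Fin 2 → MvPolynomial (Fin 2) F) 0 (X 0 - 1))).toLinearMap
      (aeval (R := F) (Function.update (X : Fin 2 → MvPolynomial (Fin 2) F) 1 (X 1 - 1))).toLinearMap := by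
    have : (aeval (Function.update (X : Fin 2 → MvPolynomial (Fin 2) F) 0 (X 0 - 1))).comp
      (aeval (Function.update (X : Fin 2 → MvPolynomial (Fin 2) F) 1 (X 1 - 1))) =
      (aeval (Function.update (X : Fin 2 → MvPolynomial (Fin 2) F) 1 (X 1 - 1))).comp
      (aeval (Function.update (X : Fin 2 → MvPolynomial (Fin 2) F) 0 (X 0 - 1))) := by
      ext k
      fin_cases k <;> simp
    exact congrArg AlgHom.toLinearMap this
  have h1 : ∀ f : Module.End F (MvPolynomial (Fin 2) F), Commute LinearMap.id f :=
    fun f => Commute.one_left f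
  exact Commute.sub_left (h1 _) (Commute.sub_right (h1 _).symm key)

theorem Tl_mul (i j k l : ℕ) : Tl F i j * Tl F k l = Tl F (i + k) (j + l) := by
  have h : Commute (Dl F 1 ^ j) (Dl F 0 ^ k) := (Dl_comm.symm.pow_pow j k)
  unfold Tl
  rw [pow_add, pow_add, mul_assoc, ← mul_assoc (Dl F 1 ^ j), h.eq]
  simp only [mul_assoc]

theorem deg_aux (i : Fin 2) (a : ℕ) :
    degreeOf i ((X i : MvPolynomial (Fin 2) F) ^ a - (X i - 1) ^ a) ≤ a - 1 := by
  have hX : degreeOf i (X i : MvPolynomial (Fin 2) F) ≤ 1 := by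
    rw [degreeOf_X_self]
  have hX1 : degreeOf i (X i - 1 : MvPolynomial (Fin 2) F) ≤ 1 := by
    refine (degreeOf_sub_le _ _ _).trans ?_
    rw [degreeOf_one]; simpa using hX
  induction a with
  | zero => simp
  | succ a ih =>
    rcases Nat.eq_zero_or_pos a with rfl | ha
    · have : ((X i : MvPolynomial (Fin 2) F) ^ (0 + 1) - (X i - 1) ^ (0 + 1)) = 1 := by ring
      rw [this]; simp [degreeOf_one]
    · have : ((X i : MvPolynomial (Fin 2) F) ^ (a + 1) - (X i - 1) ^ (a + 1)) =
        X i * (X i ^ a - (X i - 1) ^ a) + (X i - 1) ^ a := by ring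
      rw [this]
      refine (degreeOf_add_le _ _ _).trans (max_le ?_ ?_)
      · refine (degreeOf_mul_le _ _ _).trans ?_
        omega
      · refine (degreeOf_pow_le _ _ _).trans ?_
        nlinarith [Nat.succ_sub_one a]

theorem deg_aux' (i j : Fin 2) (h : j ≠ i) (a : ℕ) :
    degreeOf j ((X i : MvPolynomial (Fin 2) F) ^ a - (X i - 1) ^ a) = 0 := by
  have hX : degreeOf j (X i : MvPolynomial (Fin 2) F) = 0 := degreeOf_X_of_ne h
  have hX1 : degreeOf j (X i - 1 : MvPolynomial (Fin 2) F) = 0 := by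
    have := (degreeOf_sub_le j (X i : MvPolynomial (Fin 2) F) 1)
    rw [degreeOf_one, hX] at this; simpa using this
  have h1 := degreeOf_pow_le j (X i : MvPolynomial (Fin 2) F) a
  have h2 := degreeOf_pow_le j (X i - 1 : MvPolynomial (Fin 2) F) a
  have h3 := (degreeOf_sub_le j ((X i : MvPolynomial (Fin 2) F) ^ a) ((X i - 1) ^ a))
  rw [hX] at h1
  rw [hX1] at h2
  simp only [mul_zero, Nat.le_zero] at h1 h2
  rw [h1, h2] at h3
  simpa using h3

theorem Dl_monomial (i k : Fin 2) (hk : k ≠ i) (s : Fin 2 →₀ ℕ) (c : F) :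
    Dl F i (monomial s c) = C c * ((X i ^ s i - (X i - 1) ^ s i) * X k ^ s k) := by
  rw [Dl_apply, monomial_eq, Finsupp.prod_fintype _ _ (by simp)]
  fin_cases i <;> fin_cases k <;> simp [Fin.prod_univ_two] at hk ⊢ <;> ring

theorem exists_other (i : Fin 2) : ∃ k : Fin 2, k ≠ i := exists_ne i

theorem deg_Dl_self (i : Fin 2) (p : MvPolynomial (Fin 2) F) :
    degreeOf i (Dl F i p) ≤ degreeOf i p - 1 := by
  obtain ⟨k, hk⟩ := exists_ne i
  conv_lhs => rw [p.as_sum, map_sum]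
  refine (degreeOf_sum_le _ _ _).trans (Finset.sup_le fun s hs => ?_)
  rw [Dl_monomial i k hk]
  refine (degreeOf_C_mul_le _ _ _).trans ((degreeOf_mul_le _ _ _).trans ?_)
  have h1 := deg_aux (F := F) i (s i)
  have h2 := degreeOf_pow_le i (X k : MvPolynomial (Fin 2) F) (s k)
  rw [degreeOf_X_of_ne hk.symm] at h2
  have h3 : s i ≤ degreeOf i p := by
    exact le_degreeOf_of_mem_support i hs
  omega

theorem deg_Dl_ne (i k : Fin 2) (hk : k ≠ i) (p : MvPolynomial (Fin 2) F) :
    degreeOf k (Dl F i p) ≤ degreeOf k p := by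
  conv_lhs => rw [p.as_sum, map_sum]
  refine (degreeOf_sum_le _ _ _).trans (Finset.sup_le fun s hs => ?_)
  rw [Dl_monomial i k hk]
  refine (degreeOf_C_mul_le _ _ _).trans ((degreeOf_mul_le _ _ _).trans ?_)
  have h1 := deg_aux' (F := F) i k hk (s i)
  have h2 := degreeOf_pow_le k (X k : MvPolynomial (Fin 2) F) (s k)
  rw [degreeOf_X_self] at h2
  have h3 : s k ≤ degreeOf k p := by
    exact le_degreeOf_of_mem_support k hs
  omega

theorem Dl_eq_zero (i : Fin 2) (p : MvPolynomial (Fin 2) F) (h : degreeOf i p = 0) :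
    Dl F i p = 0 := by
  obtain ⟨k, hk⟩ := exists_ne i
  conv_lhs => rw [p.as_sum, map_sum]
  refine Finset.sum_eq_zero fun s hs => ?_
  have h3 : s i ≤ degreeOf i p := le_degreeOf_of_mem_support i hs
  have : s i = 0 := by omega
  rw [Dl_monomial i k hk, this]
  simp

theorem Tl_succ_left (i j : ℕ) (p : MvPolynomial (Fin 2) F) :
    Tl F (i + 1) j p = Dl F 0 (Tl F i j p) := by
  unfold Tl; rw [pow_succ', mul_assoc]; rfl

theorem Tl_succ_right (i j : ℕ) (p : MvPolynomial (Fin 2) F) :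
    Tl F i (j + 1) p = Dl F 1 (Tl F i j p) := by
  have := Tl_mul (F := F) 0 1 i j
  rw [zero_add, add_comm 1 j] at this
  rw [← this]
  simp [Tl]

theorem Tl_succ_left' (i j : ℕ) (p : MvPolynomial (Fin 2) F) :
    Tl F (i + 1) j p = Tl F i j (Dl F 0 p) := by
  have := Tl_mul (F := F) i j 1 0
  rw [add_zero] at this
  rw [← this]
  simp [Tl]

theorem Tl_succ_right' (i j : ℕ) (p : MvPolynomial (Fin 2) F) :
    Tl F i (j + 1) p = Tl F i j (Dl F 1 p) := by
  unfold Tl; rw [pow_succ, ← mul_assoc]; rfl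

theorem deg_Tl (i j : ℕ) (p : MvPolynomial (Fin 2) F) :
    degreeOf 0 (Tl F i j p) ≤ degreeOf 0 p - i ∧ degreeOf 1 (Tl F i j p) ≤ degreeOf 1 p - j := by
  induction i with
  | zero =>
    induction j with
    | zero => simp [Tl]
    | succ j ih =>
      rw [Tl_succ_right]
      have h1 := deg_Dl_self 1 (Tl F 0 j p)
      have h2 := deg_Dl_ne 1 0 (by decide) (Tl F 0 j p)
      omega
  | succ i ih =>
    rw [Tl_succ_left]
    have h1 := deg_Dl_self 0 (Tl F i j p)
    have h2 := deg_Dl_ne 0 1 (by decide) (Tl F i j p)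
    omega

theorem Tl_eq_zero (i j : ℕ) (p : MvPolynomial (Fin 2) F)
    (h : degreeOf 0 p < i ∨ degreeOf 1 p < j) : Tl F i j p = 0 := by
  rcases h with h | h
  · obtain ⟨i, rfl⟩ : ∃ k, i = k + 1 := ⟨i - 1, by omega⟩
    rw [Tl_succ_left]
    apply Dl_eq_zero
    have := (deg_Tl i j p).1
    omega
  · obtain ⟨j, rfl⟩ : ∃ k, j = k + 1 := ⟨j - 1, by omega⟩
    rw [Tl_succ_right]
    apply Dl_eq_zero
    have := (deg_Tl i j p).2
    omega

theorem const_of_deg (p : MvPolynomial (Fin 2) F) (h0 : degreeOf 0 p = 0) (h1 : degreeOf 1 p = 0) :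
    ∃ c, p = C c := by
  refine ⟨coeff 0 p, ?_⟩
  ext s
  rw [coeff_C]
  split_ifs with hs
  · rw [hs]
  · by_contra hne
    have hm : s ∈ p.support := mem_support_iff.mpr hne
    have a0 : s 0 ≤ degreeOf 0 p := le_degreeOf_of_mem_support 0 hm
    have a1 : s 1 ≤ degreeOf 1 p := le_degreeOf_of_mem_support 1 hm
    apply hs
    ext k
    fin_cases k
    · simp; omega
    · simp; omega

theorem const_of_Dl [CharZero F] (p : MvPolynomial (Fin 2) F) (h0 : Dl F 0 p = 0)
    (h1 : Dl F 1 p = 0) : ∃ c, p = C c := by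
  have e0 : ∀ x y : F, eval ![x - 1, y] p = eval ![x, y] p := by
    intro x y
    rw [← bdiffx_eq, bdiffx, sub_eq_zero] at h0
    conv_rhs => rw [h0]
    rw [← coe_aeval_eq_eval, ← coe_aeval_eq_eval]
    simp only [RingHom.coe_coe]
    rw [← AlgHom.comp_apply, comp_aeval]
    congr 2
    funext k
    fin_cases k <;> simp
  have e1 : ∀ x y : F, eval ![x, y - 1] p = eval ![x, y] p := by
    intro x y
    rw [← bdiffy_eq, bdiffy, sub_eq_zero] at h1
    conv_rhs => rw [h1]
    rw [← coe_aeval_eq_eval, ← coe_aeval_eq_eval]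
    simp only [RingHom.coe_coe]
    rw [← AlgHom.comp_apply, comp_aeval]
    congr 2
    funext k
    fin_cases k <;> simp
  have f0 : ∀ (k : ℕ) (y : F), eval ![(k : F), y] p = eval ![0, y] p := by
    intro k y
    induction k with
    | zero => simp
    | succ k ih => rw [← ih, ← e0]; simp
  have f1 : ∀ (k : ℕ) (y : F), eval ![y, (k : F)] p = eval ![y, 0] p := by
    intro k y
    induction k with
    | zero => simp
    | succ k ih => rw [← ih, ← e1]; simp
  refine ⟨eval ![0, 0] p, ?_⟩
  refine MvPolynomial.funext_set (fun _ => Set.range (fun k : ℕ => (k : F)))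
    (fun _ => Set.infinite_range_of_injective Nat.cast_injective) ?_
  intro x hx
  obtain ⟨a, ha⟩ := hx 0 (Set.mem_univ _)
  obtain ⟨b, hb⟩ := hx 1 (Set.mem_univ _)
  have : x = ![(a : F), (b : F)] := by
    funext k
    fin_cases k
    · exact ha.symm
    · exact hb.symm
  rw [this, f0, f1]; simp

theorem uniq [CharZero F] : ∀ (N a b : ℕ) (_ : a + b ≤ N) (Z : ℕ → ℕ → F × F)
    (p : MvPolynomial (Fin 2) F) (_ : degreeOf 0 p ≤ a) (_ : degreeOf 1 p ≤ b)
    (_ : ∀ i ≤ a, ∀ j ≤ b, eval ![(Z i j).1, (Z i j).2] (Tl F i j p) = 0), p = 0 := by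
  intro N
  induction N with
  | zero =>
    intro a b hab Z p h0 h1 hv
    obtain ⟨c, rfl⟩ := const_of_deg p (by omega) (by omega)
    simpa [Tl] using hv 0 (Nat.zero_le _) 0 (Nat.zero_le _)
  | succ N ih =>
    intro a b hab Z p h0 h1 hv
    have d0 : Dl F 0 p = 0 := by
      rcases a with _ | a
      · exact Dl_eq_zero 0 p (by omega)
      · refine ih a b (by omega) (fun i j => Z (i + 1) j) _ ?_ ?_ ?_
        · have := deg_Dl_self 0 p
          omega
        · exact (deg_Dl_ne 0 1 (by decide) p).trans h1
        · intro i hi j hj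
          rw [← Tl_succ_left']
          exact hv (i + 1) (by omega) j hj
    have d1 : Dl F 1 p = 0 := by
      rcases b with _ | b
      · exact Dl_eq_zero 1 p (by omega)
      · refine ih a b (by omega) (fun i j => Z i (j + 1)) _ ?_ ?_ ?_
        · exact (deg_Dl_ne 1 0 (by decide) p).trans h0
        · have := deg_Dl_self 1 p
          omega
        · intro i hi j hj
          rw [← Tl_succ_right']
          exact hv i hi (j + 1) (by omega)
    obtain ⟨c, rfl⟩ := const_of_Dl p d0 d1
    simpa [Tl] using hv 0 (Nat.zero_le _) 0 (Nat.zero_le _)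

theorem deg_C_mul_sub (i : Fin 2) (a : ℕ) (c : F) (p q : MvPolynomial (Fin 2) F)
    (hp : degreeOf i p ≤ a) (hq : degreeOf i q ≤ a) : degreeOf i (p - C c * q) ≤ a :=
  (degreeOf_sub_le _ _ _).trans (max_le hp ((degreeOf_C_mul_le _ _ _).trans hq))

end

/-- **Bivariate perturbation formula.** Let `(i₀,j₀) ≼ (m,n)` with `(i₀,j₀) ≠ (m,n)`,
and let `Z*` be obtained from `Z` by replacing the node `z_{i₀,j₀}` with `z*`.  Then
`g̃_{m,n}((x,y); Z*) = g̃_{m,n}((x,y); Z)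
  - C(m,i₀)·C(n,j₀)·g̃_{m-i₀,n-j₀}(z*; L^{i₀}D^{j₀}Z)·g̃_{i₀,j₀}((x,y); Z)`. -/
theorem bivariate_perturbation_formula (F : Type*) [Field F] [CharZero F]
    (m n i₀ j₀ : ℕ) (hi : i₀ ≤ m) (hj : j₀ ≤ n) (hne : (i₀, j₀) ≠ (m, n))
    (Z : ℕ → ℕ → F × F) (zstar : F × F) (g gstar h gij : MvPolynomial (Fin 2) F)
    (hg : IsDiffGoncarov2 m n Z g)
    (hgstar : IsDiffGoncarov2 m n
      (fun i j => if i = i₀ ∧ j = j₀ then zstar else Z i j) gstar)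
    (hh : IsDiffGoncarov2 (m - i₀) (n - j₀) (fun k l => Z (k + i₀) (l + j₀)) h)
    (hgij : IsDiffGoncarov2 i₀ j₀ Z gij) :
    gstar = g - MvPolynomial.C ((m.choose i₀ : F) * (n.choose j₀ : F) *
        MvPolynomial.eval ![zstar.1, zstar.2] h) * gij := by
  obtain ⟨g0, g1, hg⟩ := hg
  obtain ⟨s0, s1, hs⟩ := hgstar
  obtain ⟨h0, h1, hh⟩ := hh
  obtain ⟨k0, k1, hk⟩ := hgij
  simp only [iter_eq] at hg hs hh hk
  -- the mixed difference of `g` is a multiple of `h`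
  set A : F := (m.factorial : F) * (n.factorial : F) with hA
  set B : F := ((m - i₀).factorial : F) * ((n - j₀).factorial : F) with hB
  have hB0 : B ≠ 0 := mul_ne_zero (Nat.cast_ne_zero.mpr (Nat.factorial_ne_zero _))
    (Nat.cast_ne_zero.mpr (Nat.factorial_ne_zero _))
  have hdeg := deg_Tl i₀ j₀ g
  have q0 : Tl F i₀ j₀ g - MvPolynomial.C (A / B) * h = 0 := by
    refine uniq _ (m - i₀) (n - j₀) le_rfl (fun k l => Z (k + i₀) (l + j₀)) _
      (deg_C_mul_sub _ _ _ _ _ (by omega) h0) (deg_C_mul_sub _ _ _ _ _ (by omega) h1) ?_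
    intro i hi' j hj'
    have e1 : Tl F i j (Tl F i₀ j₀ g) = Tl F (i + i₀) (j + j₀) g := by
      rw [← Tl_mul]; rfl
    rw [map_sub, ← MvPolynomial.smul_eq_C_mul, map_smul, map_sub, e1, MvPolynomial.smul_eval,
      hg _ (by omega) _ (by omega), hh i hi' j hj']
    have : (i + i₀ = m ∧ j + j₀ = n) ↔ (i = m - i₀ ∧ j = n - j₀) := by omega
    simp only [this]
    split_ifs
    · field_simp; simp
    · simp
  have q1 : MvPolynomial.eval ![zstar.1, zstar.2] (Tl F i₀ j₀ g) =
      A / B * MvPolynomial.eval ![zstar.1, zstar.2] h := by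
    rw [sub_eq_zero.mp q0]; simp
  have q2 : MvPolynomial.eval ![zstar.1, zstar.2] (Tl F i₀ j₀ gij) =
      (i₀.factorial : F) * (j₀.factorial : F) := by
    have hd := deg_Tl i₀ j₀ gij
    obtain ⟨c, hc⟩ := const_of_deg (Tl F i₀ j₀ gij) (by omega) (by omega)
    have := hk i₀ le_rfl j₀ le_rfl
    rw [hc] at this ⊢
    simpa using this
  have hAB : A / B = (m.choose i₀ : F) * (n.choose j₀ : F) *
      ((i₀.factorial : F) * (j₀.factorial : F)) := by
    rw [div_eq_iff hB0, hA, hB, ← Nat.choose_mul_factorial_mul_factorial hi,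
      ← Nat.choose_mul_factorial_mul_factorial hj]
    push_cast
    ring
  set c : F := (m.choose i₀ : F) * (n.choose j₀ : F) *
        MvPolynomial.eval ![zstar.1, zstar.2] h with hc
  have hne' : ¬ (i₀ = m ∧ j₀ = n) := fun hx => hne (by rw [hx.1, hx.2])
  rw [← sub_eq_zero]
  refine uniq _ m n le_rfl (fun i j => if i = i₀ ∧ j = j₀ then zstar else Z i j) _
    ((MvPolynomial.degreeOf_sub_le _ _ _).trans (max_le s0
      (deg_C_mul_sub _ _ _ _ _ g0 (k0.trans hi))))
    ((MvPolynomial.degreeOf_sub_le _ _ _).trans (max_le s1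
      (deg_C_mul_sub _ _ _ _ _ g1 (k1.trans hj)))) ?_
  intro i hi' j hj'
  rw [map_sub, map_sub, hs i hi' j hj', ← MvPolynomial.smul_eq_C_mul, map_sub, map_smul, map_sub,
    MvPolynomial.smul_eval]
  by_cases hij : i = i₀ ∧ j = j₀
  · obtain ⟨rfl, rfl⟩ := hij
    simp only [and_self, if_true, if_neg hne']
    rw [q1, q2, hAB, hc]
    ring
  · simp only [if_neg hij]
    rw [hg i hi' j hj']
    have : MvPolynomial.eval ![(Z i j).1, (Z i j).2] (Tl F i j gij) = 0 := by
      by_cases hle : i ≤ i₀ ∧ j ≤ j₀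
      · rw [hk i hle.1 j hle.2, if_neg hij]
      · rw [Tl_eq_zero i j gij (by omega), map_zero]
    rw [this]
    simp
end

section
/- (Bivariate delta Abel formula) Let a, b, c, d ∈ F and let Z be the node set with x_{i,j} = a·i + b·j and y_{i,j} = c·i + d·j for all i, j ∈ ℕ. Then for all m, n ≥ 1, g̃_{m,n}((x,y); Z) = (xy − x_{0,n}·y − y_{m,0}·x)·(x − x_{m,n} + 1)^{(m−1)}·(y − y_{m,n} + 1)^{(n−1)}, i.e., g̃_{m,n}((x,y); Z) = (xy − bn·y − cm·x)·(x − am − bn + 1)^{(m−1)}·(y − cm − dn + 1)^{(n−1)}, as an identity in F[x,y]. -/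
open Finset

open MvPolynomial in
theorem eval_bdiffx {F : Type*} [Field F] (p : MvPolynomial (Fin 2) F) (x y : F) :
    eval ![x, y] (bdiffx p) = eval ![x, y] p - eval ![x - 1, y] p := by
  have h : (eval ![x, y]).comp
      (aeval (R := F) ![(X 0 : MvPolynomial (Fin 2) F) - 1, X 1]).toRingHom = eval ![x - 1, y] := by
    apply MvPolynomial.ringHom_ext
    · intro r; simp
    · intro i; fin_cases i <;> simp
  have h2 := congrArg (fun f => f p) h
  simp only [RingHom.comp_apply] at h2
  rw [bdiffx, map_sub, ← h2]; rfl

open MvPolynomial in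
theorem eval_bdiffy {F : Type*} [Field F] (p : MvPolynomial (Fin 2) F) (x y : F) :
    eval ![x, y] (bdiffy p) = eval ![x, y] p - eval ![x, y - 1] p := by
  have h : (eval ![x, y]).comp
      (aeval (R := F) ![(X 0 : MvPolynomial (Fin 2) F), X 1 - 1]).toRingHom = eval ![x, y - 1] := by
    apply MvPolynomial.ringHom_ext
    · intro r; simp
    · intro i; fin_cases i <;> simp
  have h2 := congrArg (fun f => f p) h
  simp only [RingHom.comp_apply] at h2
  rw [bdiffy, map_sub, ← h2]; rfl

theorem ext2 {F : Type*} [Field F] [CharZero F] {p q : MvPolynomial (Fin 2) F}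
    (h : ∀ x y, MvPolynomial.eval ![x, y] p = MvPolynomial.eval ![x, y] q) : p = q := by
  apply MvPolynomial.funext
  intro v
  have : v = ![v 0, v 1] := by ext i; fin_cases i <;> rfl
  rw [this]; exact h _ _

/-- backward difference of functions -/
def bD {F : Type*} [Field F] (f : F → F) : F → F := fun x => f x - f (x - 1)

theorem eval_bdiffx_iter {F : Type*} [Field F] (i : ℕ) (p : MvPolynomial (Fin 2) F) (x y : F) :
    MvPolynomial.eval ![x, y] (bdiffx^[i] p) = bD^[i] (fun s => MvPolynomial.eval ![s, y] p) x := by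
  induction i generalizing p with
  | zero => rfl
  | succ i ih =>
    rw [Function.iterate_succ_apply, Function.iterate_succ_apply, ih]
    exact congrArg (fun f => bD^[i] f x) (funext fun s => eval_bdiffx p s y)

theorem eval_bdiffy_iter {F : Type*} [Field F] (i : ℕ) (p : MvPolynomial (Fin 2) F) (x y : F) :
    MvPolynomial.eval ![x, y] (bdiffy^[i] p) = bD^[i] (fun s => MvPolynomial.eval ![x, s] p) y := by
  induction i generalizing p with
  | zero => rfl
  | succ i ih =>
    rw [Function.iterate_succ_apply, Function.iterate_succ_apply, ih]
    exact congrArg (fun f => bD^[i] f y) (funext fun s => eval_bdiffy p x s)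

theorem bdiff_comm {F : Type*} [Field F] [CharZero F] :
    Function.Commute (bdiffx (F := F)) bdiffy := by
  intro p
  apply ext2
  intro x y
  simp only [eval_bdiffx, eval_bdiffy]; ring

theorem bD_lin {F : Type*} [Field F] (i : ℕ) (u v : F) (f g : F → F) :
    bD^[i] (fun x => u * f x + v * g x) = fun x => u * bD^[i] f x + v * bD^[i] g x := by
  induction i generalizing f g with
  | zero => rfl
  | succ i ih =>
    simp only [Function.iterate_succ_apply]
    rw [← ih]
    congr 1; ext x; simp only [bD]; ring

theorem bdiffx_sub {F : Type*} [Field F] (i : ℕ) (p q : MvPolynomial (Fin 2) F) :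
    bdiffx^[i] (p - q) = bdiffx^[i] p - bdiffx^[i] q := by
  induction i generalizing p q with
  | zero => rfl
  | succ i ih =>
    simp only [Function.iterate_succ_apply]
    rw [← ih]
    congr 1; simp only [bdiffx, map_sub]; ring

theorem bdiffy_sub {F : Type*} [Field F] (i : ℕ) (p q : MvPolynomial (Fin 2) F) :
    bdiffy^[i] (p - q) = bdiffy^[i] p - bdiffy^[i] q := by
  induction i generalizing p q with
  | zero => rfl
  | succ i ih =>
    simp only [Function.iterate_succ_apply]
    rw [← ih]
    congr 1; simp only [bdiffy, map_sub]; ring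

theorem bD_fwd {F : Type*} [Field F] (i : ℕ) (f : F → F) (x : F) :
    bD^[i] f x = (fwdDiff 1)^[i] f (x - i) := by
  induction i generalizing x with
  | zero => simp
  | succ i ih =>
    rw [Function.iterate_succ_apply', Function.iterate_succ_apply', bD, ih, ih, fwdDiff]
    push_cast
    congr 2 <;> ring_nf

theorem exists_uni {F : Type*} [Field F] (p : MvPolynomial (Fin 2) F) (k : Fin 2) (v : Fin 2 → F) :
    ∃ r : Polynomial F, r.natDegree ≤ p.degreeOf k ∧
      ∀ x, r.eval x = MvPolynomial.eval (Function.update v k x) p := by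
  refine ⟨MvPolynomial.aeval (Function.update (fun i => Polynomial.C (v i)) k Polynomial.X) p,
    ?_, ?_⟩
  · rw [MvPolynomial.aeval_def, MvPolynomial.eval₂_eq]
    apply Polynomial.natDegree_sum_le_of_forall_le
    intro e he
    refine (Polynomial.natDegree_C_mul_le _ _).trans ?_
    refine (Polynomial.natDegree_prod_le _ _).trans ?_
    refine le_trans ?_ (MvPolynomial.monomial_le_degreeOf k he)
    calc _ ≤ ∑ i ∈ e.support, if i = k then e k else 0 := by
          apply Finset.sum_le_sum
          intro i _
          by_cases h : i = k
          · subst h; simp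
          · simp only [Function.update_of_ne h, if_neg h, ← Polynomial.C_pow]; simp
      _ ≤ e k := by
          rw [Finset.sum_ite_eq']; split_ifs <;> simp
  · intro x
    rw [← Polynomial.coe_evalRingHom, MvPolynomial.aeval_def, MvPolynomial.hom_eval₂]
    rw [MvPolynomial.eval, MvPolynomial.coe_eval₂Hom]
    congr 1
    · ext; simp
    · ext i
      by_cases h : i = k
      · subst h; simp
      · simp [Function.update_of_ne h]

theorem exists_uni0 {F : Type*} [Field F] (p : MvPolynomial (Fin 2) F) (y : F) :
    ∃ r : Polynomial F, r.natDegree ≤ p.degreeOf 0 ∧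
      ∀ x, r.eval x = MvPolynomial.eval ![x, y] p := by
  obtain ⟨r, h1, h2⟩ := exists_uni p 0 ![0, y]
  refine ⟨r, h1, fun x => ?_⟩
  rw [h2]; congr 2; ext i; fin_cases i <;> simp

theorem exists_uni1 {F : Type*} [Field F] (p : MvPolynomial (Fin 2) F) (x : F) :
    ∃ r : Polynomial F, r.natDegree ≤ p.degreeOf 1 ∧
      ∀ y, r.eval y = MvPolynomial.eval ![x, y] p := by
  obtain ⟨r, h1, h2⟩ := exists_uni p 1 ![x, 0]
  refine ⟨r, h1, fun x => ?_⟩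
  rw [h2]; congr 2; ext i; fin_cases i <;> simp

theorem bD_poly_zero {F : Type*} [Field F] (r : Polynomial F) (m : ℕ) (h : r.natDegree ≤ m) (x : F) :
    bD^[m+1] r.eval x = 0 := by
  rw [bD_fwd, Polynomial.fwdDiff_iter_eq_zero_of_degree_lt (by omega)]; rfl

theorem poly_const {F : Type*} [Field F] [CharZero F] (r : Polynomial F)
    (h : ∀ x, r.eval x - r.eval (x - 1) = 0) (x y : F) : r.eval x = r.eval y := by
  have h1 : ∀ k : ℕ, r.eval (k : F) = r.eval 0 := by
    intro k
    induction k with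
    | zero => simp
    | succ k ih => have := h ((k + 1 : ℕ) : F); push_cast at this ⊢
                   rw [add_sub_cancel_right, ih] at this; exact sub_eq_zero.mp this
  have : r = Polynomial.C (r.eval 0) := by
    apply Polynomial.eq_of_infinite_eval_eq
    refine (Set.infinite_range_of_injective (Nat.cast_injective (R := F))).mono ?_
    rintro _ ⟨k, rfl⟩
    simp [h1]
  rw [this]; simp

theorem bdiffx_deg {F : Type*} [Field F] [CharZero F] (p : MvPolynomial (Fin 2) F) (m : ℕ)
    (h : p.degreeOf 0 ≤ m) : bdiffx^[m+1] p = 0 := by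
  apply ext2
  intro x y
  obtain ⟨r, h1, h2⟩ := exists_uni0 p y
  rw [eval_bdiffx_iter, ← funext h2, map_zero]
  exact bD_poly_zero r m (h1.trans h) x

theorem bdiffy_deg {F : Type*} [Field F] [CharZero F] (p : MvPolynomial (Fin 2) F) (m : ℕ)
    (h : p.degreeOf 1 ≤ m) : bdiffy^[m+1] p = 0 := by
  apply ext2
  intro x y
  obtain ⟨r, h1, h2⟩ := exists_uni1 p x
  rw [eval_bdiffy_iter, ← funext h2, map_zero]
  exact bD_poly_zero r m (h1.trans h) y

theorem const_of_bdiff {F : Type*} [Field F] [CharZero F] (p : MvPolynomial (Fin 2) F)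
    (hx : bdiffx p = 0) (hy : bdiffy p = 0) (x y : F)
    (h : MvPolynomial.eval ![x, y] p = 0) : p = 0 := by
  apply ext2
  intro s t
  rw [map_zero, ← h]
  trans MvPolynomial.eval ![x, t] p
  · obtain ⟨r, -, h2⟩ := exists_uni0 p t
    rw [← h2, ← h2]
    apply poly_const
    intro u
    rw [h2, h2, ← eval_bdiffx, hx, map_zero]
  · obtain ⟨r, -, h2⟩ := exists_uni1 p x
    rw [← h2, ← h2]
    apply poly_const
    intro u
    rw [h2, h2, ← eval_bdiffy, hy, map_zero]

theorem goncarov_unique {F : Type*} [Field F] [CharZero F] (p : MvPolynomial (Fin 2) F) (m n : ℕ)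
    (hx : bdiffx^[m+1] p = 0) (hy : bdiffy^[n+1] p = 0) (X Y : ℕ → ℕ → F)
    (h : ∀ i ≤ m, ∀ j ≤ n,
      MvPolynomial.eval ![X i j, Y i j] (bdiffx^[i] (bdiffy^[j] p)) = 0) : p = 0 := by
  have zx : ∀ k, bdiffx^[k] (0 : MvPolynomial (Fin 2) F) = 0 :=
    fun k => Function.iterate_fixed (by simp [bdiffx]) k
  have zy : ∀ k, bdiffy^[k] (0 : MvPolynomial (Fin 2) F) = 0 :=
    fun k => Function.iterate_fixed (by simp [bdiffy]) k
  have key : ∀ k i j, i ≤ m + 1 → j ≤ n + 1 → (m + 1 - i) + (n + 1 - j) = k →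
      bdiffx^[i] (bdiffy^[j] p) = 0 := by
    intro k
    induction k with
    | zero =>
      intro i j hi hj hk
      obtain rfl : j = n + 1 := by omega
      rw [hy, zx]
    | succ k ih =>
      intro i j hi hj hk
      by_cases h1 : j = n + 1
      · rw [h1, hy, zx]
      by_cases h2 : i = m + 1
      · rw [h2, (bdiff_comm.iterate_iterate _ _).eq, hx, zy]
      refine const_of_bdiff _ ?_ ?_ _ _ (h i (by omega) j (by omega))
      · rw [← Function.iterate_succ_apply' bdiffx]
        exact ih (i+1) j (by omega) hj (by omega)
      · rw [← (bdiff_comm.iterate_left i).eq, ← Function.iterate_succ_apply' bdiffy]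
        exact ih i (j+1) hi (by omega) (by omega)
  exact key _ 0 0 (by omega) (by omega) rfl

theorem map_upf {R S : Type*} [CommRing R] [CommRing S] (f : R →+* S) (t : R) (k : ℕ) :
    f (upf t k) = upf (f t) k := by
  induction k with
  | zero => simp [upf]
  | succ k ih => simp [upf, ih]

theorem upf_succ_left {R : Type*} [CommRing R] (t : R) (k : ℕ) :
    upf t (k+1) = t * upf (t + 1) k := by
  induction k with
  | zero => simp [upf]
  | succ k ih => rw [upf, ih, upf]; push_cast; ring

theorem bD_upf {F : Type*} [Field F] (s : F) (i k : ℕ) :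
    bD^[i] (fun x => upf (x - s) k) = fun x => (k.descFactorial i : F) * upf (x - s) (k - i) := by
  induction i with
  | zero => simp
  | succ i ih =>
    rw [Function.iterate_succ_apply', ih]
    ext x
    rw [bD, Nat.descFactorial_succ]
    rcases hk : k - i with _ | l
    · simp [upf]
    · rw [upf_succ_left (x - 1 - s), upf, show k - (i + 1) = l by omega,
        show x - 1 - s + 1 = x - s by ring]
      push_cast; ring

theorem bD_U {F : Type*} [Field F] (s : F) (i k : ℕ) :
    bD^[i] (fun x => upf (x - s + 1) k) =
      fun x => (k.descFactorial i : F) * upf (x - s + 1) (k - i) := by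
  have := bD_upf (s - 1) i k
  simpa only [sub_sub_eq_add_sub, add_sub_right_comm] using this

theorem bD_P {F : Type*} [Field F] (a w : F) (i M : ℕ) :
    bD^[i] (fun x => (x - w) * upf (x - (a * ((M + 1 : ℕ) : F) + w) + 1) M) =
    fun x => ((M+1).descFactorial i : F) * upf (x - (a * ((M + 1 : ℕ) : F) + w)) (M + 1 - i) +
      a * ((M + 1 : ℕ) : F) *
        ((M.descFactorial i : F) * upf (x - (a * ((M + 1 : ℕ) : F) + w) + 1) (M - i)) := by
  have h := bD_lin i 1 (a * ((M + 1 : ℕ) : F)) (fun x => upf (x - (a * ((M + 1 : ℕ) : F) + w)) (M + 1))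
    (fun x => upf (x - (a * ((M + 1 : ℕ) : F) + w) + 1) M)
  rw [bD_upf, bD_U] at h
  simp only [one_mul] at h
  rw [← h]
  congr 1; ext x; rw [upf_succ_left]; ring

/-- Evaluation at a node. -/
theorem bD_P_node {F : Type*} [Field F] [CharZero F] (a b : F) (i M n j : ℕ) (hi : i ≤ M) :
    (((M + 1 : ℕ) : F) - i) *
      bD^[i] (fun x => (x - b * n) * upf (x - (a * ((M + 1 : ℕ) : F) + b * n) + 1) M)
        (a * i + b * j) =
    - (b * ((M + 1 : ℕ) : F) * (n - j)) *
      bD^[i] (fun x => upf (x - (a * ((M + 1 : ℕ) : F) + b * n) + 1) M) (a * i + b * j) := by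
  rw [bD_P, bD_U]
  have hd : (((M + 1 : ℕ) : F) - i) * ((M+1).descFactorial i : F) =
      ((M + 1 : ℕ) : F) * (M.descFactorial i : F) := by
    have := Nat.succ_descFactorial M i
    have h2 : ((M + 1 - i : ℕ) : F) = ((M + 1 : ℕ) : F) - i := Nat.cast_sub (by omega)
    rw [← h2]; exact_mod_cast this
  rw [show M + 1 - i = (M - i) + 1 by omega]
  beta_reduce
  rw [upf_succ_left]
  generalize upf (a * (i : F) + b * j - (a * ((M + 1 : ℕ) : F) + b * n) + 1) (M - i) = W
  linear_combination (a * i + b * j - (a * ((M + 1 : ℕ) : F) + b * n)) * W * hd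

theorem bD_P_top {F : Type*} [Field F] (a w : F) (M : ℕ) (x : F) :
    bD^[M+1] (fun x => (x - w) * upf (x - (a * ((M + 1 : ℕ) : F) + w) + 1) M) x =
      ((M+1).factorial : F) := by
  rw [bD_P]
  rw [Nat.descFactorial_self, Nat.descFactorial_of_lt (show M < M + 1 by omega)]
  simp [upf]

theorem bD_U_top {F : Type*} [Field F] (s : F) (M i : ℕ) (h : M < i) (x : F) :
    bD^[i] (fun x => upf (x - s + 1) M) x = 0 := by
  rw [bD_U]
  simp [Nat.descFactorial_of_lt h]

theorem bD_P_top2 {F : Type*} [Field F] (a w : F) (M : ℕ) (x : F) :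
    bD^[M+1+1] (fun x => (x - w) * upf (x - (a * ((M + 1 : ℕ) : F) + w) + 1) M) x = 0 := by
  rw [bD_P]
  rw [Nat.descFactorial_of_lt (show M + 1 < M + 1 + 1 by omega),
    Nat.descFactorial_of_lt (show M < M + 1 + 1 by omega)]
  simp

theorem eval_split {F : Type*} [Field F] (P Q U V : F → F) (k : F)
    (G : MvPolynomial (Fin 2) F)
    (hG : ∀ x y, MvPolynomial.eval ![x, y] G = P x * Q y + k * U x * V y) (i j : ℕ) (x y : F) :
    MvPolynomial.eval ![x, y] (bdiffx^[i] (bdiffy^[j] G)) =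
      bD^[i] P x * bD^[j] Q y + k * bD^[i] U x * bD^[j] V y := by
  rw [eval_bdiffx_iter]
  simp only [eval_bdiffy_iter, hG]
  have h1 : ∀ s, bD^[j] (fun t => P s * Q t + k * U s * V t) y =
      bD^[j] Q y * P s + k * bD^[j] V y * U s := by
    intro s; rw [bD_lin]; ring
  simp only [h1]
  rw [bD_lin]; ring

/-- **Bivariate delta Abel formula.** If the node set is the linear grid
`z_{i,j} = (a·i + b·j, c·i + d·j)`, then for `m, n ≥ 1`,
`g̃_{m,n}((x,y); Z) = (xy - bn·y - cm·x)·(x - am - bn + 1)^{(m-1)}·(y - cm - dn + 1)^{(n-1)}`. -/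
theorem bivariate_delta_abel (F : Type*) [Field F] [CharZero F]
    (a b c d : F) (m n : ℕ) (hm : 1 ≤ m) (hn : 1 ≤ n)
    (g : MvPolynomial (Fin 2) F)
    (hg : IsDiffGoncarov2 m n
      (fun i j => (a * (i : F) + b * (j : F), c * (i : F) + d * (j : F))) g) :
    g = (MvPolynomial.X 0 * MvPolynomial.X 1 -
          MvPolynomial.C (b * (n : F)) * MvPolynomial.X 1 -
          MvPolynomial.C (c * (m : F)) * MvPolynomial.X 0) *
        upf (MvPolynomial.X 0 - MvPolynomial.C (a * (m : F) + b * (n : F)) + 1) (m - 1) *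
        upf (MvPolynomial.X 1 - MvPolynomial.C (c * (m : F) + d * (n : F)) + 1) (n - 1) := by
  obtain ⟨M, rfl⟩ : ∃ M, m = M + 1 := ⟨m - 1, by omega⟩
  obtain ⟨N, rfl⟩ : ∃ N, n = N + 1 := ⟨n - 1, by omega⟩
  obtain ⟨hg0, hg1, hg2⟩ := hg
  simp only [Nat.add_sub_cancel]
  set G : MvPolynomial (Fin 2) F := (MvPolynomial.X 0 * MvPolynomial.X 1 -
          MvPolynomial.C (b * ((N + 1 : ℕ) : F)) * MvPolynomial.X 1 -
          MvPolynomial.C (c * ((M + 1 : ℕ) : F)) * MvPolynomial.X 0) *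
        upf (MvPolynomial.X 0 -
          MvPolynomial.C (a * ((M + 1 : ℕ) : F) + b * ((N + 1 : ℕ) : F)) + 1) M *
        upf (MvPolynomial.X 1 -
          MvPolynomial.C (c * ((M + 1 : ℕ) : F) + d * ((N + 1 : ℕ) : F)) + 1) N with hGdef
  have hG : ∀ x y, MvPolynomial.eval ![x, y] G =
      (fun x => (x - b * ((N + 1 : ℕ) : F)) *
        upf (x - (a * ((M + 1 : ℕ) : F) + b * ((N + 1 : ℕ) : F)) + 1) M) x *
      (fun y => (y - c * ((M + 1 : ℕ) : F)) *
        upf (y - (d * ((N + 1 : ℕ) : F) + c * ((M + 1 : ℕ) : F)) + 1) N) y +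
      (-(b * c * ((M + 1 : ℕ) : F) * ((N + 1 : ℕ) : F))) *
      (fun x => upf (x - (a * ((M + 1 : ℕ) : F) + b * ((N + 1 : ℕ) : F)) + 1) M) x *
      (fun y => upf (y - (d * ((N + 1 : ℕ) : F) + c * ((M + 1 : ℕ) : F)) + 1) N) y := by
    intro x y
    rw [hGdef, add_comm (c * ((M + 1 : ℕ) : F)) (d * ((N + 1 : ℕ) : F))]
    simp only [map_mul, map_upf, map_sub, map_add, map_one, MvPolynomial.eval_X,
      MvPolynomial.eval_C, Matrix.cons_val_zero, Matrix.cons_val_one]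
    ring
  have hS := eval_split _ _ _ _ _ G hG
  rw [← sub_eq_zero]
  refine goncarov_unique (g - G) (M + 1) (N + 1) ?_ ?_
    (fun i j => a * (i : F) + b * (j : F)) (fun i j => c * (i : F) + d * (j : F)) ?_
  · rw [bdiffx_sub, bdiffx_deg _ _ hg0, zero_sub, neg_eq_zero]
    apply ext2
    intro x y
    have := hS (M + 1 + 1) 0 x y
    rw [bD_P_top2, bD_U_top _ _ _ (by omega)] at this
    simpa using this
  · rw [bdiffy_sub, bdiffy_deg _ _ hg1, zero_sub, neg_eq_zero]
    apply ext2
    intro x y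
    have := hS 0 (N + 1 + 1) x y
    rw [bD_P_top2, bD_U_top _ N _ (by omega)] at this
    simpa using this
  · intro i hi j hj
    rw [bdiffy_sub, bdiffx_sub, map_sub, sub_eq_zero]
    refine (hg2 i hi j hj).trans ?_
    rw [hS]
    have hP := bD_P_node a b i M (N + 1) j
    have hQ := bD_P_node d c j N (M + 1) i
    rw [add_comm (d * (j : F)) (c * (i : F))] at hQ
    rcases Nat.lt_or_ge i (M + 1) with hi2 | hi2
    · have hP := hP (by omega)
      have hi0 : (((M + 1 : ℕ) : F) - i) ≠ 0 :=
        sub_ne_zero.mpr (by exact_mod_cast (show M + 1 ≠ i by omega))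
      rw [if_neg (by omega)]
      rcases Nat.lt_or_ge j (N + 1) with hj2 | hj2
      · have hQ := hQ (by omega)
        have hj0 : (((N + 1 : ℕ) : F) - j) ≠ 0 :=
          sub_ne_zero.mpr (by exact_mod_cast (show N + 1 ≠ j by omega))
        symm
        refine (mul_eq_zero.mp ?_).resolve_left (mul_ne_zero hi0 hj0)
        have key : ∀ A B A2 B2 e f : F, e * A = -(b * ((M + 1 : ℕ) : F) * f) * A2 →
            f * B = -(c * ((N + 1 : ℕ) : F) * e) * B2 →
            e * f * (A * B + -(b * c * ((M + 1 : ℕ) : F) * ((N + 1 : ℕ) : F)) * A2 * B2) = 0 := by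
          intro A B A2 B2 e f h1 h2
          linear_combination (f * B) * h1 - (b * ((M + 1 : ℕ) : F) * f) * A2 * h2
        exact key _ _ _ _ _ _ hP hQ
      · obtain rfl : j = N + 1 := by omega
        rw [bD_U_top _ N _ (by omega)]
        rw [sub_self, mul_zero, neg_zero, zero_mul] at hP
        rw [(mul_eq_zero.mp hP).resolve_left hi0]
        simp
    · obtain rfl : i = M + 1 := by omega
      rw [bD_U_top _ M _ (by omega), bD_P_top]
      rcases Nat.lt_or_ge j (N + 1) with hj2 | hj2
      · have hQ := hQ (by omega)
        have hj0 : (((N + 1 : ℕ) : F) - j) ≠ 0 :=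
          sub_ne_zero.mpr (by exact_mod_cast (show N + 1 ≠ j by omega))
        rw [sub_self, mul_zero, neg_zero, zero_mul] at hQ
        rw [(mul_eq_zero.mp hQ).resolve_left hj0, if_neg (by omega)]
        simp
      · obtain rfl : j = N + 1 := by omega
        rw [bD_P_top]
        simp
end
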